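/- Fix d ≥ 2. For every p > 0 there exists ε > 0 such that for all sufficiently large n and every set S ⊆ B[n] with |S| ≤ ε b_n, the probability that a simple random walk started at the origin first exits S at a point of ∂B[n] (i.e. that ξ(t_S) ∈ ∂B[n]) is at most p. -/

import Mathlib

open MeasureTheory Filter
open scoped ENNReal

noncomputable section

/-- The `k`-th binary digit of `x ∈ [0,1)` (after the binary point). -/
def bit (x : ℝ) (k : ℕ) : Bool := ⌊x * 2 ^ (k + 1)⌋ % 2 == 1

/-- From one uniform sample on `[0,1]`, extract countably many independent uniform
samples on `[0,1]`, using disjoint subsequences of binary digits. -/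
def uSlice (x : ℝ) (i : ℕ) : ℝ :=
  ∑' j : ℕ, if bit x (Nat.pair i j) then ((2 : ℝ) ^ (-(j : ℤ) - 1)) else 0

/-- The base probability space: Lebesgue measure restricted to `[0,1]`. -/
def μ0 : Measure ℝ := volume.restrict (Set.Icc 0 1)

/-- The vertex set of the lattice `ℤ^d`. -/
abbrev V (d : ℕ) := Fin d → ℤ

instance (d : ℕ) : MeasurableSpace (Finset (V d)) := ⊤

open Classical in
/-- `B[r]`: the Euclidean ball of radius `r` in `ℤ^d`, as a `Finset`. -/
def ball (d : ℕ) (r : ℝ) : Finset (V d) :=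
  (Finset.Icc (fun _ => -⌈r⌉) (fun _ => ⌈r⌉)).filter
    (fun y => Real.sqrt (∑ i, ((y i : ℝ)) ^ 2) ≤ r)

/-- `b_n`: the number of lattice points in the Euclidean ball of radius `n`. -/
def bn (d n : ℕ) : ℕ := (ball d n).card

/-- The `2d` unit vectors of `ℤ^d` (the possible steps of the simple random walk). -/
def unitVecs (d : ℕ) : Finset (V d) :=
  Finset.image
    (fun p : Fin d × Bool => fun j => if j = p.1 then (if p.2 then 1 else -1) else 0)
    Finset.univ

/-- Given `u` uniform on `[0,1]`, `pick S u` is a uniformly chosen element of `S`. -/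
def pick {d : ℕ} (S : Finset (V d)) (u : ℝ) : V d :=
  if h : S.Nonempty then
    (S.equivFin.symm ⟨(⌊u * S.card⌋).toNat % S.card,
      Nat.mod_lt _ (Finset.card_pos.mpr h)⟩).val
  else 0

/-- Position at time `t` of the simple random walk started at `x`, driven by the
random seed `ω`: the steps `pick (unitVecs d) (uSlice ω i)` are i.i.d. uniform on
the `2d` unit vectors when `ω` is uniform on `[0,1]`. -/
def walk {d : ℕ} (x : V d) (ω : ℝ) (t : ℕ) : V d :=
  x + ∑ i ∈ Finset.range t, pick (unitVecs d) (uSlice ω i)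

/-- `t_S`: the first time the walk started at `x` is outside `S`. -/
def exitT {d : ℕ} (S : Finset (V d)) (x : V d) (ω : ℝ) : ℕ :=
  sInf {t | walk x ω t ∉ S}

/-- The position `ξ(t_S)` at which the walk started at `x` first exits `S`. -/
def hitPt {d : ℕ} (S : Finset (V d)) (x : V d) (ω : ℝ) : V d :=
  walk x ω (exitT S x ω)

/-- `Add[ξ,S]`: add to `S` the exit point of a random walk started at `x`. -/
def addPt {d : ℕ} (S : Finset (V d)) (x : V d) (ω : ℝ) : Finset (V d) :=
  insert (hitPt S x ω) S

/-- `P_x(ξ(τ_A) = y)`: the probability that the walk started at `x` exits `A` at `y`. -/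
def hitProb {d : ℕ} (A : Finset (V d)) (x y : V d) : ℝ≥0∞ :=
  μ0 {ω | hitPt A x ω = y}

/-- The outer boundary `∂A`: vertices outside `A` with a neighbour in `A`. -/
def outb {d : ℕ} (A : Finset (V d)) : Finset (V d) :=
  (A.biUnion fun x => (unitVecs d).image (fun e => x + e)) \ A

/-- `DA_X(S)`: the IDLA aggregate obtained from `S` by launching one particle from each
point of the list `xs` in turn (driven by independent slices of the seed `ω`). -/
def daFrom {d : ℕ} : Finset (V d) → List (V d) → ℝ → Finset (V d)
  | S, [], _ => S
  | S, x :: xs, ω => daFrom (addPt S x (uSlice ω 0)) xs (uSlice ω 1)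

/-- The law of the IDLA aggregate `DA_X(S)`. -/
def daLaw {d : ℕ} (S : Finset (V d)) (xs : List (V d)) : Measure (Finset (V d)) :=
  μ0.map (fun ω => daFrom S xs ω)

/-- One uIDLA step: launch a particle from a uniformly chosen point of `S`. -/
def uStep {d : ℕ} (S : Finset (V d)) (ω : ℝ) : Finset (V d) :=
  addPt S (pick S (uSlice ω 0)) (uSlice ω 1)

/-- `A_k(S)`: the uIDLA aggregate obtained by adding `k` particles to `S`,
each started at a uniform point of the current aggregate. -/
def uAggFrom {d : ℕ} (S : Finset (V d)) (ω : ℝ) : ℕ → Finset (V d)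
  | 0 => S
  | k + 1 => uStep (uAggFrom S ω k) (uSlice ω k)

/-- The law of the uIDLA aggregate `A_k(S)`. -/
def uLaw {d : ℕ} (S : Finset (V d)) (k : ℕ) : Measure (Finset (V d)) :=
  μ0.map (fun ω => uAggFrom S ω k)

/-- One step of the subset uIDLA `A_·(E;m)`: at step `k`, perform a uIDLA step
with probability `|E|/(m+k)` and otherwise do nothing. -/
def subStep {d : ℕ} (m k : ℕ) (E : Finset (V d)) (ω : ℝ) : Finset (V d) :=
  if uSlice ω 0 * ((m : ℝ) + k) ≤ E.card then uStep E (uSlice ω 1) else E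

/-- The subset uIDLA `A_n(E;m)`. -/
def subAggFrom {d : ℕ} (E : Finset (V d)) (m : ℕ) (ω : ℝ) : ℕ → Finset (V d)
  | 0 => E
  | k + 1 => subStep m k (subAggFrom E m ω k) (uSlice ω k)

/-- The law of the subset uIDLA `A_n(E;m)`. -/
def subLaw {d : ℕ} (E : Finset (V d)) (m k : ℕ) : Measure (Finset (V d)) :=
  μ0.map (fun ω => subAggFrom E m ω k)

/-- Stochastic domination of random finite subsets of `ℤ^d`: `μ` dominates `ν` if
there is a coupling under which the sample of `ν` is a.s. contained in that of `μ`. -/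
def StochDom {d : ℕ} (μ ν : Measure (Finset (V d))) : Prop :=
  ∃ π : Measure (Finset (V d) × Finset (V d)), IsProbabilityMeasure π ∧
    π.map Prod.fst = μ ∧ π.map Prod.snd = ν ∧ π {p | p.2 ⊆ p.1} = 1

/-- A `Geometric(1/2)` sample (taking value `j ≥ 0` with probability `2^{-(j+1)}`)
produced from a uniform sample `u` on `[0,1]` by inverting the CDF. -/
def geom (u : ℝ) : ℕ := sInf {j : ℕ | u ≤ 1 - (2 : ℝ) ^ (-(j : ℤ) - 1)}

/-- The parent of vertex `j ≥ 1` in the uniform random recursive tree (vertex `0` is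
the root): uniform on `{0, …, j-1}` when the seed is uniform on `[0,1]`. -/
def parent (ω : ℝ) (j : ℕ) : ℕ := (⌊uSlice ω (Nat.pair 0 j) * j⌋).toNat % j

/-- The reaching time of vertex `j` in a uniform random recursive tree whose edges
carry i.i.d. `Geometric(1/2)` weights: the sum of the weights on the path from the
root to `j`. (The `min` is a.s. inoperative, since a.s. `parent ω (j+1) ≤ j`.) -/
def reach (ω : ℝ) : ℕ → ℕ
  | 0 => 0
  | j + 1 => reach ω (min (parent ω (j + 1)) j) + geom (uSlice ω (Nat.pair 1 (j + 1)))
termination_by j => j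
decreasing_by exact Nat.lt_succ_of_le (min_le_right _ _)

end


open MeasureTheory Measure

/-- fair coin -/
noncomputable def coin : Measure Bool := (2⁻¹ : ℝ≥0∞) • (Measure.dirac false + Measure.dirac true)

instance coin_prob : IsProbabilityMeasure coin := ⟨by
  rw [coin, Measure.smul_apply, Measure.add_apply, measure_univ, measure_univ, smul_eq_mul,
    one_add_one_eq_two]
  exact ENNReal.inv_mul_cancel (by norm_num) (by norm_num)⟩

lemma bit_succ (x : ℝ) (k : ℕ) : bit x (k + 1) = bit (2 * x) k := by
  unfold bit
  rw [show x * 2 ^ (k + 1 + 1) = 2 * x * 2 ^ (k + 1) by ring]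

lemma bit_sub_one (x : ℝ) (k : ℕ) : bit (x - 1) k = bit x k := by
  unfold bit
  have : (x - 1) * 2 ^ (k + 1) = x * 2 ^ (k + 1) - ((2 ^ (k + 1) : ℤ) : ℝ) := by push_cast; ring
  rw [this, Int.floor_sub_intCast]
  have : (⌊x * 2 ^ (k + 1)⌋ - 2 ^ (k + 1)) % 2 = ⌊x * 2 ^ (k + 1)⌋ % 2 := by
    rw [pow_succ]; omega
  rw [this]

lemma bit_zero_false {x : ℝ} (h0 : 0 ≤ x) (h1 : x < 1 / 2) : bit x 0 = false := by
  unfold bit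
  have : ⌊x * 2 ^ (0 + 1)⌋ = 0 := by
    rw [Int.floor_eq_iff]; norm_num; constructor <;> linarith
  rw [this]; rfl

lemma bit_zero_true {x : ℝ} (h0 : 1 / 2 ≤ x) (h1 : x < 1) : bit x 0 = true := by
  unfold bit
  have : ⌊x * 2 ^ (0 + 1)⌋ = 1 := by
    rw [Int.floor_eq_iff]; norm_num; constructor <;> linarith
  rw [this]; rfl

lemma measurable_bit (k : ℕ) : Measurable (fun x => bit x k) := by
  unfold bit
  have h : Measurable (fun x : ℝ => ⌊x * 2 ^ (k + 1)⌋) := by fun_prop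
  exact (measurable_from_top (f := fun z : ℤ => (z % 2 == 1))).comp h

lemma measurable_bits : Measurable (fun x k => bit x k) :=
  measurable_pi_lambda _ measurable_bit

/-- set of points with prescribed digits -/
def digSet (m : ℕ) (t : ℕ → Set Bool) : Set ℝ :=
  {x | (0 ≤ x ∧ x < 1) ∧ ∀ k < m, bit x k ∈ t k}

lemma coin_apply (t : Set Bool) : coin t = 2⁻¹ * (t.indicator 1 false + t.indicator 1 true) := by
  simp [coin, mul_add]

lemma measurableSet_digSet (m : ℕ) (t : ℕ → Set Bool) : MeasurableSet (digSet m t) := by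
  have : digSet m t = Set.Ico 0 1 ∩ ⋂ k, ⋂ (_ : k < m), (fun x => bit x k) ⁻¹' (t k) := by
    ext x; simp [digSet]
  rw [this]
  refine measurableSet_Ico.inter (.iInter fun k => .iInter fun _ => measurable_bit k (.of_discrete))

lemma volume_digSet (m : ℕ) : ∀ t : ℕ → Set Bool,
    volume (digSet m t) = ∏ k ∈ Finset.range m, coin (t k) := by
  induction m with
  | zero =>
    intro t
    have : digSet 0 t = Set.Ico 0 1 := by ext x; simp [digSet]
    simp [this]
  | succ m ih =>
    intro t
    classical
    have hs : digSet (m + 1) t =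
        (if false ∈ t 0 then (fun x => 2 * x) ⁻¹' (digSet m fun k => t (k + 1)) else ∅) ∪
        (if true ∈ t 0 then (fun x => 2 * x) ⁻¹' ((fun y => y + (-1)) ⁻¹'
          (digSet m fun k => t (k + 1))) else ∅) := by
      ext x
      have key : x ∈ digSet (m + 1) t ↔ (0 ≤ x ∧ x < 1) ∧ bit x 0 ∈ t 0 ∧
          ∀ k < m, bit (2 * x) k ∈ t (k + 1) := by
        simp only [digSet, Set.mem_ofPred_eq]
        refine and_congr Iff.rfl ⟨fun h => ⟨h 0 (by omega), fun k hk => ?_⟩, fun h k hk => ?_⟩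
        · rw [← bit_succ]; exact h _ (by omega)
        · cases k with
          | zero => exact h.1
          | succ k => rw [bit_succ]; exact h.2 _ (by omega)
      rw [key]
      have e1 : x ∈ (if false ∈ t 0 then (fun x => 2 * x) ⁻¹' (digSet m fun k => t (k + 1)) else ∅)
          ↔ false ∈ t 0 ∧ (0 ≤ 2 * x ∧ 2 * x < 1) ∧ ∀ k < m, bit (2 * x) k ∈ t (k + 1) := by
        split_ifs with h <;> simp [h, digSet]
      have e2 : x ∈ (if true ∈ t 0 then (fun x => 2 * x) ⁻¹' ((fun y => y + (-1)) ⁻¹'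
          (digSet m fun k => t (k + 1))) else ∅)
          ↔ true ∈ t 0 ∧ (0 ≤ 2 * x - 1 ∧ 2 * x - 1 < 1) ∧
            ∀ k < m, bit (2 * x) k ∈ t (k + 1) := by
        split_ifs with h
        · simp only [h, digSet, Set.mem_preimage, Set.mem_ofPred_eq, ← sub_eq_add_neg, bit_sub_one,
            true_and]
        · simp [h]
      rw [Set.mem_union, e1, e2]
      constructor
      · rintro ⟨⟨h0, h1⟩, hb, hr⟩
        rcases lt_or_ge x (1 / 2) with h | h
        · left; rw [bit_zero_false h0 h] at hb
          exact ⟨hb, ⟨by linarith, by linarith⟩, hr⟩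
        · right; rw [bit_zero_true h h1] at hb
          exact ⟨hb, ⟨by linarith, by linarith⟩, hr⟩
      · rintro (⟨hb, ⟨h0, h1⟩, hr⟩ | ⟨hb, ⟨h0, h1⟩, hr⟩)
        · refine ⟨⟨by linarith, by linarith⟩, ?_, hr⟩
          rwa [bit_zero_false (by linarith) (by linarith)]
        · refine ⟨⟨by linarith, by linarith⟩, ?_, hr⟩
          rwa [bit_zero_true (by linarith) (by linarith)]
    have hm := measurableSet_digSet m fun k => t (k + 1)
    have hm2 : MeasurableSet ((fun x : ℝ => 2 * x) ⁻¹' ((fun y => y + (-1)) ⁻¹'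
          (digSet m fun k => t (k + 1)))) := by
      apply MeasurableSet.preimage _ (by fun_prop)
      exact hm.preimage (by fun_prop)
    have v1 : volume ((fun x : ℝ => 2 * x) ⁻¹' (digSet m fun k => t (k + 1))) =
        2⁻¹ * ∏ k ∈ Finset.range m, coin (t (k + 1)) := by
      rw [Real.volume_preimage_mul_left (by norm_num), ih]
      congr 1
      rw [abs_of_pos (by norm_num), ENNReal.ofReal_inv_of_pos (by norm_num)]; simp
    have v2 : volume ((fun x : ℝ => 2 * x) ⁻¹' ((fun y => y + (-1)) ⁻¹'
          (digSet m fun k => t (k + 1)))) =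
        2⁻¹ * ∏ k ∈ Finset.range m, coin (t (k + 1)) := by
      rw [Real.volume_preimage_mul_left (by norm_num), measure_preimage_add_right, ih]
      congr 1
      rw [abs_of_pos (by norm_num), ENNReal.ofReal_inv_of_pos (by norm_num)]; simp
    rw [hs, measure_union, Finset.prod_range_succ', coin_apply (t 0)]
    · split_ifs with h1 h2 h2 <;> simp [h1, h2, v1, v2] <;> ring
    · rw [Set.disjoint_left]
      intro x h1 h2
      split_ifs at h1 h2 <;> simp_all [digSet]
      linarith
    · split_ifs
      · exact hm2
      · exact .empty

instance mu0_prob : IsProbabilityMeasure μ0 := ⟨by simp [μ0]⟩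

lemma mu0_eq : μ0 = volume.restrict (Set.Ico 0 1) := by
  unfold μ0; exact Measure.restrict_congr_set Ico_ae_eq_Icc.symm

lemma map_bits : μ0.map (fun x k => bit x k) = Measure.infinitePi (fun _ : ℕ => coin) := by
  refine Measure.eq_infinitePi _ fun s t ht => ?_
  classical
  rw [Measure.map_apply measurable_bits (.pi s.countable_toSet fun _ _ => ht _), mu0_eq,
    Measure.restrict_apply (measurable_bits (.pi s.countable_toSet fun _ _ => ht _))]
  obtain ⟨m, hm⟩ := s.exists_nat_subset_range
  have : (fun x k => bit x k) ⁻¹' (s : Set ℕ).pi t ∩ Set.Ico 0 1 =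
      digSet m (fun k => if k ∈ s then t k else Set.univ) := by
    ext x
    simp only [Set.mem_inter_iff, Set.mem_preimage, Set.mem_pi, digSet, Set.mem_Ico,
      Set.mem_ofPred_eq]
    rw [and_comm]
    refine and_congr Iff.rfl ⟨fun h k hk => ?_, fun h k hk => ?_⟩
    · split_ifs with hs
      · exact h k hs
      · trivial
    · have := h k (Finset.mem_range.1 (hm hk))
      rwa [if_pos (by exact hk)] at this
  rw [this, volume_digSet]
  rw [← Finset.prod_subset hm (f := fun k => coin (if k ∈ s then t k else Set.univ))]
  · refine Finset.prod_congr rfl fun k hk => by rw [if_pos hk]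
  · intro k _ hk; simp only [hk, if_false]; exact measure_univ

/-- binary expansion value -/
noncomputable def binVal (b : ℕ → Bool) : ℝ := ∑' j : ℕ, if b j then ((2 : ℝ) ^ (-(j : ℤ) - 1)) else 0

lemma measurable_binVal : Measurable binVal := by
  have hs : ∀ b : ℕ → Bool, Summable fun j : ℕ => if b j then ((2 : ℝ) ^ (-(j : ℤ) - 1)) else 0 := by
    intro b
    refine Summable.of_nonneg_of_le (f := fun j : ℕ => (1 / 2 : ℝ) ^ j) ?_ ?_ summable_geometric_two
    · intro j; split_ifs <;> positivity
    · intro j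
      have : (2 : ℝ) ^ (-(j : ℤ) - 1) = (1 / 2) ^ j * (1 / 2) := by
        rw [zpow_sub₀ (by norm_num), zpow_neg, zpow_natCast]; simp; ring
      split_ifs
      · rw [this]; nlinarith [show (0 : ℝ) < (1 / 2) ^ j by positivity]
      · positivity
  refine measurable_of_tendsto_metrizable
    (f := fun n b => ∑ j ∈ Finset.range n, if b j then ((2 : ℝ) ^ (-(j : ℤ) - 1)) else 0) ?_ ?_
  · intro n
    refine Finset.measurable_sum _ fun j _ => ?_
    exact (measurable_from_top (f := fun c : Bool => if c then ((2 : ℝ) ^ (-(j : ℤ) - 1)) else 0)).comp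
      (measurable_pi_apply j)
  · rw [tendsto_pi_nhds]
    intro b
    exact (hs b).hasSum.tendsto_sum_nat

lemma partial_bits (x : ℝ) (h0 : 0 ≤ x) (h1 : x < 1) (m : ℕ) :
    ∑ j ∈ Finset.range m, (if bit x j then ((2 : ℝ) ^ (-(j : ℤ) - 1)) else 0) = ⌊x * 2 ^ m⌋ / 2 ^ m := by
  induction m with
  | zero => simp; rw [eq_comm]; exact_mod_cast Int.floor_eq_zero_iff.2 ⟨h0, h1⟩
  | succ m ih =>
    rw [Finset.sum_range_succ, ih]
    have hz : (2 : ℝ) ^ (-(m : ℤ) - 1) = 1 / 2 ^ (m + 1) := by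
      rw [zpow_sub₀ (by norm_num), zpow_neg, zpow_natCast, pow_succ]; simp; ring
    have hf : ⌊x * 2 ^ m⌋ = ⌊x * 2 ^ (m + 1)⌋ / 2 := by
      have : x * 2 ^ m = x * 2 ^ (m + 1) / ((2 : ℕ) : ℝ) := by push_cast; ring
      rw [this, Int.floor_div_natCast]; rfl
    set F := ⌊x * 2 ^ (m + 1)⌋ with hF
    have hb : bit x m = (F % 2 == 1) := rfl
    rw [hf, hb, hz]
    have hdm : F = 2 * (F / 2) + F % 2 := by omega
    have : (F : ℝ) = 2 * ((F / 2 : ℤ) : ℝ) + ((F % 2 : ℤ) : ℝ) := by exact_mod_cast hdm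
    rw [this]
    rcases Int.emod_two_eq_zero_or_one F with h | h
    · simp [h]; field_simp; ring
    · simp [h]; field_simp; ring

lemma binVal_bits (x : ℝ) (h0 : 0 ≤ x) (h1 : x < 1) : binVal (fun k => bit x k) = x := by
  unfold binVal
  have hx : HasSum (fun j : ℕ => if bit x j then ((2 : ℝ) ^ (-(j : ℤ) - 1)) else 0) x := by
    rw [hasSum_iff_tendsto_nat_of_nonneg]
    · simp_rw [partial_bits x h0 h1]
      have hp : Tendsto (fun m : ℕ => ((1 / 2 : ℝ)) ^ m) atTop (nhds 0) :=
        tendsto_pow_atTop_nhds_zero_of_lt_one (by norm_num) (by norm_num)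
      have hl : Tendsto (fun m : ℕ => x - ((1 / 2 : ℝ)) ^ m) atTop (nhds x) := by
        simpa using tendsto_const_nhds.sub hp
      refine tendsto_of_tendsto_of_tendsto_of_le_of_le hl tendsto_const_nhds ?_ ?_
      · intro m
        have h2 : (0 : ℝ) < 2 ^ m := by positivity
        have := Int.lt_floor_add_one (x * 2 ^ m)
        simp only [one_div, inv_pow]
        rw [le_div_iff₀ h2, sub_mul, inv_mul_cancel₀ h2.ne.symm]; linarith
      · intro m
        have h2 : (0 : ℝ) < 2 ^ m := by positivity
        simp only
        rw [div_le_iff₀ h2]; exact Int.floor_le _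
    · intro j; split_ifs <;> positivity
  exact hx.tsum_eq

lemma uSlice_eq (x : ℝ) (i : ℕ) : uSlice x i = binVal (fun j => bit x (Nat.pair i j)) := rfl

lemma map_binVal : (Measure.infinitePi (fun _ : ℕ => coin)).map binVal = μ0 := by
  rw [← map_bits, Measure.map_map measurable_binVal measurable_bits]
  have : (binVal ∘ fun x k => bit x k) =ᵐ[μ0] id := by
    rw [mu0_eq]
    filter_upwards [ae_restrict_mem measurableSet_Ico] with x hx
    exact binVal_bits x hx.1 hx.2
  rw [Measure.map_congr this, Measure.map_id]

lemma map_pair : (Measure.infinitePi (fun _ : ℕ => coin)).map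
    (fun b (i j : ℕ) => b (Nat.pair i j)) =
    Measure.infinitePi (fun _ : ℕ => Measure.infinitePi (fun _ : ℕ => coin)) := by
  have h1 := Measure.infinitePi_map_piCongrLeft (fun _ : ℕ × ℕ => coin) Nat.pairEquiv.symm
  have h2 := Measure.infinitePi_map_curry (ι := ℕ) (κ := ℕ) (fun _ _ => coin)
  rw [← h2, ← h1, Measure.map_map (by fun_prop) (by fun_prop)]
  congr 1
  funext b i j
  simp [MeasurableEquiv.piCongrLeft, Equiv.piCongrLeft, MeasurableEquiv.curry]

lemma map_uSlice : μ0.map (fun x i => uSlice x i) = Measure.infinitePi (fun _ : ℕ => μ0) := by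
  have hp : Measurable (fun (b : ℕ → Bool) (i j : ℕ) => b (Nat.pair i j)) := by fun_prop
  have hv : Measurable (fun (c : ℕ → ℕ → Bool) (i : ℕ) => binVal (c i)) :=
    measurable_pi_lambda _ fun i => measurable_binVal.comp (measurable_pi_apply i)
  have h := Measure.infinitePi_map_pi (fun _ : ℕ => Measure.infinitePi (fun _ : ℕ => coin))
    (f := fun _ => binVal) (fun _ => measurable_binVal)
  simp only [map_binVal] at h
  rw [← h, ← map_pair, ← map_bits, Measure.map_map hp measurable_bits,
    Measure.map_map hv (hp.comp measurable_bits)]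
  rfl

lemma measurable_uSlice : Measurable (fun x i => uSlice x i) := by
  refine measurable_pi_lambda _ fun i => ?_
  exact measurable_binVal.comp (measurable_pi_lambda _ fun j => measurable_bit _)

lemma measurable_pick {d : ℕ} (S : Finset (V d)) : Measurable (pick S) := by
  unfold pick
  by_cases h : S.Nonempty
  · simp only [h, dite_true]
    have hm : Measurable (fun u : ℝ => ⌊u * S.card⌋) := by fun_prop
    exact (measurable_from_top (f := fun z : ℤ => ((S.equivFin.symm ⟨z.toNat % S.card,
      Nat.mod_lt _ (Finset.card_pos.mpr h)⟩).val : V d))).comp hm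
  · simp only [h, dite_false]; exact measurable_const

lemma pick_mem {d : ℕ} (S : Finset (V d)) (h : S.Nonempty) (u : ℝ) : pick S u ∈ S := by
  unfold pick; rw [dif_pos h]; exact Subtype.prop _

/-- step law -/
noncomputable def stepLaw (d : ℕ) : Measure (V d) := μ0.map (pick (unitVecs d))

instance stepLaw_prob (d : ℕ) : IsProbabilityMeasure (stepLaw d) :=
  Measure.isProbabilityMeasure_map (measurable_pick _).aemeasurable

lemma pick_singleton {d : ℕ} (S : Finset (V d)) (v : V d) (hv : v ∈ S) :
    (μ0.map (pick S)) {v} = (S.card : ℝ≥0∞)⁻¹ := by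
  have hne : S.Nonempty := ⟨v, hv⟩
  have hc : 0 < S.card := Finset.card_pos.2 hne
  have hcR : (0 : ℝ) < S.card := by exact_mod_cast hc
  set k := S.equivFin ⟨v, hv⟩ with hk
  rw [Measure.map_apply (measurable_pick S) (measurableSet_singleton _), mu0_eq,
    Measure.restrict_apply ((measurable_pick S) (measurableSet_singleton _))]
  have : pick S ⁻¹' {v} ∩ Set.Ico 0 1 = Set.Ico ((k : ℕ) / S.card : ℝ) (((k : ℕ) + 1) / S.card) := by
    ext u
    simp only [Set.mem_inter_iff, Set.mem_preimage, Set.mem_singleton_iff, Set.mem_Ico]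
    rw [div_le_iff₀ hcR, lt_div_iff₀ hcR]
    have e : ∀ (h0 : 0 ≤ u) (h1 : u < 1), pick S u = v ↔ ⌊u * S.card⌋ = (k : ℕ) := by
      intro h0 h1
      have f0 : 0 ≤ ⌊u * S.card⌋ := Int.floor_nonneg.2 (by positivity)
      have f1 : ⌊u * S.card⌋ < S.card := by
        rw [Int.floor_lt]; push_cast; nlinarith
      have f2 : (⌊u * S.card⌋).toNat % S.card = (⌊u * S.card⌋).toNat :=
        Nat.mod_eq_of_lt (by omega)
      unfold pick
      rw [dif_pos hne]
      have : ((S.equivFin.symm ⟨(⌊u * S.card⌋).toNat % S.card,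
        Nat.mod_lt _ (Finset.card_pos.mpr hne)⟩).val = v) ↔
        S.equivFin.symm ⟨(⌊u * S.card⌋).toNat % S.card,
        Nat.mod_lt _ (Finset.card_pos.mpr hne)⟩ = ⟨v, hv⟩ := by
          rw [Subtype.ext_iff]
      rw [this, Equiv.symm_apply_eq, ← hk, Fin.ext_iff]
      simp only [f2]; omega
    constructor
    · rintro ⟨hp, h0, h1⟩
      rw [e h0 h1, Int.floor_eq_iff] at hp
      exact_mod_cast hp
    · rintro ⟨h0, h1⟩
      have hk1 : ((k : ℕ) : ℝ) + 1 ≤ S.card := by exact_mod_cast k.2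
      have u0 : 0 ≤ u := by
        by_contra hu; push Not at hu
        have : (0 : ℝ) ≤ (k : ℕ) := by positivity
        nlinarith
      have u1 : u < 1 := by
        by_contra hu; push Not at hu
        nlinarith
      refine ⟨(e u0 u1).2 ?_, u0, u1⟩
      rw [Int.floor_eq_iff]; push_cast; exact ⟨h0, h1⟩
  rw [this, Real.volume_Ico, ← sub_div, add_sub_cancel_left, one_div,
    ENNReal.ofReal_inv_of_pos hcR, ENNReal.ofReal_natCast]

/-- the path law -/
noncomputable def pathLaw (d : ℕ) : Measure (ℕ → V d) := Measure.infinitePi (fun _ => stepLaw d)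

instance pathLaw_prob (d : ℕ) : IsProbabilityMeasure (pathLaw d) := by
  unfold pathLaw; infer_instance

lemma measurable_steps (d : ℕ) : Measurable (fun ω i => pick (unitVecs d) (uSlice ω i)) :=
  measurable_pi_lambda _ fun i =>
    (measurable_pick _).comp ((measurable_pi_apply i).comp measurable_uSlice)

lemma map_steps (d : ℕ) : μ0.map (fun ω i => pick (unitVecs d) (uSlice ω i)) = pathLaw d := by
  have h := Measure.infinitePi_map_pi (fun _ : ℕ => μ0)
    (f := fun _ => pick (unitVecs d)) (fun _ => measurable_pick _)
  unfold pathLaw stepLaw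
  rw [← h, ← map_uSlice, Measure.map_map _ measurable_uSlice]
  · rfl
  · exact measurable_pi_lambda _ fun i => (measurable_pick _).comp (measurable_pi_apply i)

/-- prepend a step -/
def consSeq {α : Type*} (p : α × (ℕ → α)) : ℕ → α
  | 0 => p.1
  | n + 1 => p.2 n

lemma measurable_consSeq {α : Type*} [MeasurableSpace α] :
    Measurable (consSeq : α × (ℕ → α) → ℕ → α) := by
  refine measurable_pi_lambda _ fun i => ?_
  cases i with
  | zero => exact measurable_fst
  | succ n => exact (measurable_pi_apply n).comp measurable_snd

lemma pathLaw_cons (d : ℕ) : ((stepLaw d).prod (pathLaw d)).map consSeq = pathLaw d := by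
  refine Measure.eq_infinitePi _ fun s t ht => ?_
  classical
  rw [Measure.map_apply measurable_consSeq (.pi s.countable_toSet fun _ _ => ht _)]
  obtain ⟨m, hm⟩ := s.exists_nat_subset_range
  set t' : ℕ → Set (V d) := fun k => if k ∈ s then t k else Set.univ with ht'
  have hmt : ∀ k, MeasurableSet (t' k) := by
    intro k; simp only [ht']; split_ifs; exacts [ht k, .univ]
  have : consSeq ⁻¹' (s : Set ℕ).pi t =
      t' 0 ×ˢ ((Finset.range m : Finset ℕ) : Set ℕ).pi (fun k => t' (k + 1)) := by
    ext p
    simp only [Set.mem_preimage, Set.mem_pi, Set.mem_prod, Finset.mem_coe, ht']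
    constructor
    · intro h
      refine ⟨?_, fun k hk => ?_⟩
      · split_ifs with h0
        · exact h 0 h0
        · trivial
      · split_ifs with h0
        · exact h (k + 1) h0
        · trivial
    · rintro ⟨h0, h1⟩ k hk
      cases k with
      | zero => rw [if_pos hk] at h0; exact h0
      | succ k =>
        have := h1 k (by have := Finset.mem_range.1 (hm hk); simp; omega)
        rw [if_pos hk] at this; exact this
  rw [this, Measure.prod_prod, pathLaw, Measure.infinitePi_pi _ (fun i _ => hmt _)]
  have hs : s ⊆ Finset.range (m + 1) := hm.trans (Finset.range_mono (by omega))
  have e := Finset.prod_subset hs (f := fun k => stepLaw d (t' k)) (by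
    intro k _ hk; simp only [ht', hk, if_false]; exact measure_univ)
  rw [Finset.prod_range_succ'] at e
  rw [mul_comm, ← e]
  exact Finset.prod_congr rfl fun k hk => by simp only [ht', if_pos hk]

lemma pathLaw_step (d : ℕ) (E : Set (ℕ → V d)) (hE : MeasurableSet E) :
    pathLaw d E = ∫⁻ e, pathLaw d {s | consSeq (e, s) ∈ E} ∂(stepLaw d) := by
  conv_lhs => rw [← pathLaw_cons, Measure.map_apply measurable_consSeq hE,
    Measure.prod_apply (measurable_consSeq hE)]
  rfl

/-- unit vector -/
def uvec {d : ℕ} (p : Fin d × Bool) : V d := fun j => if j = p.1 then (if p.2 then 1 else -1) else 0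

lemma uvec_inj (d : ℕ) : Function.Injective (uvec : Fin d × Bool → V d) := by
  rintro ⟨i, b⟩ ⟨j, c⟩ h
  have h1 := congrFun h i
  have h2 := congrFun h j
  simp only [uvec, if_true] at h1 h2
  by_cases hij : i = j
  · subst hij
    cases b <;> cases c <;> simp_all
  · rw [if_neg hij] at h1
    cases b <;> simp at h1

lemma unitVecs_eq (d : ℕ) : unitVecs d = Finset.image uvec Finset.univ := rfl

lemma card_unitVecs (d : ℕ) : (unitVecs d).card = 2 * d := by
  rw [unitVecs_eq, Finset.card_image_of_injective _ (uvec_inj d)]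
  simp [mul_comm]

lemma unitVecs_nonempty (d : ℕ) (hd : 2 ≤ d) : (unitVecs d).Nonempty := by
  rw [← Finset.card_pos, card_unitVecs]; omega

/-- averaging operator -/
noncomputable def avg {d : ℕ} (f : V d → ℝ) (x : V d) : ℝ :=
  (2 * d : ℝ)⁻¹ * ∑ p : Fin d × Bool, f (x + uvec p)

lemma lintegral_step (d : ℕ) (hd : 2 ≤ d) (f : V d → ℝ) (hf : ∀ y, 0 ≤ f y) (x : V d) :
    ∫⁻ e, ENNReal.ofReal (f (x + e)) ∂(stepLaw d) = ENNReal.ofReal (avg f x) := by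
  rw [lintegral_countable', tsum_eq_sum (s := unitVecs d)]
  · have : ∀ e ∈ unitVecs d, ENNReal.ofReal (f (x + e)) * stepLaw d {e} =
        ENNReal.ofReal ((2 * d : ℝ)⁻¹ * f (x + e)) := by
      intro e he
      rw [stepLaw, pick_singleton _ _ he, card_unitVecs, mul_comm, ENNReal.ofReal_mul (by positivity),
        ENNReal.ofReal_inv_of_pos (by positivity)]
      congr 2
      rw [show (2 * d : ℝ) = ((2 * d : ℕ) : ℝ) by push_cast; rfl, ENNReal.ofReal_natCast]
    rw [Finset.sum_congr rfl this, ← ENNReal.ofReal_sum_of_nonneg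
      (fun e _ => mul_nonneg (by positivity) (hf _)), ← Finset.mul_sum, unitVecs_eq,
      Finset.sum_image (fun a _ b _ h => uvec_inj d h)]
    rfl
  · intro e he
    have : stepLaw d {e} = 0 := by
      rw [stepLaw, Measure.map_apply (measurable_pick _) (measurableSet_singleton _)]
      have : pick (unitVecs d) ⁻¹' {e} = ∅ := by
        ext u; simp only [Set.mem_preimage, Set.mem_singleton_iff, Set.mem_empty_iff_false, iff_false]
        rintro rfl; exact he (pick_mem _ (unitVecs_nonempty d hd) u)
      rw [this]; simp
    rw [this, mul_zero]

/-- position of the walk -/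
def pos {d : ℕ} (x : V d) (s : ℕ → V d) (k : ℕ) : V d := x + ∑ i ∈ Finset.range k, s i

lemma pos_zero {d : ℕ} (x : V d) (s : ℕ → V d) : pos x s 0 = x := by simp [pos]

lemma pos_cons {d : ℕ} (x e : V d) (s : ℕ → V d) (k : ℕ) :
    pos x (consSeq (e, s)) (k + 1) = pos (x + e) s k := by
  unfold pos
  rw [Finset.sum_range_succ']
  simp only [consSeq]
  abel

lemma measurable_pos {d : ℕ} (x : V d) (k : ℕ) : Measurable (fun s => pos x s k) := by
  unfold pos; fun_prop

/-- squared length -/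
noncomputable def sqLen {d : ℕ} (x : V d) : ℝ := ∑ i, ((x i : ℝ)) ^ 2

lemma sq_nonneg' {d : ℕ} (x : V d) : 0 ≤ sqLen x := Finset.sum_nonneg fun _ _ => sq_nonneg _

lemma mem_ball_of {d n : ℕ} (x : V d) (h : sqLen x ≤ (n : ℝ) ^ 2) : x ∈ ball d n := by
  classical
  unfold ball
  rw [Finset.mem_filter]
  have hi : ∀ i, |(x i : ℝ)| ≤ n := by
    intro i
    refine abs_le_of_sq_le_sq ?_ (by positivity)
    refine le_trans ?_ h
    exact Finset.single_le_sum (f := fun i => (x i : ℝ) ^ 2) (fun _ _ => sq_nonneg _) (Finset.mem_univ i)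
  refine ⟨?_, ?_⟩
  · rw [Finset.mem_Icc]
    constructor <;> intro i <;> have := abs_le.1 (hi i) <;> simp
    · have := this.1; exact_mod_cast this
    · have := this.2; exact_mod_cast this
  · exact Real.sqrt_le_iff.2 ⟨by positivity, h⟩

lemma sq_step {d : ℕ} (x : V d) (p : Fin d × Bool) :
    sqLen (x + uvec p) = sqLen x + 2 * (x p.1) * (if p.2 then 1 else -1) + 1 := by
  unfold sqLen
  have : ∀ j, (((x + uvec p) j : ℤ) : ℝ) ^ 2 = (x j : ℝ) ^ 2 +
      if j = p.1 then 2 * (x j : ℝ) * (if p.2 then 1 else -1) + 1 else 0 := by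
    intro j
    simp only [Pi.add_apply, uvec]
    split_ifs <;> push_cast <;> ring
  simp_rw [this]
  rw [Finset.sum_add_distrib, Finset.sum_ite_eq' Finset.univ p.1]
  simp; ring

lemma avg_sq {d : ℕ} (hd : 2 ≤ d) (c a : ℝ) (x : V d) :
    avg (fun y => (sqLen y + c) / a) x = (sqLen x + 1 + c) / a := by
  unfold avg
  have hd' : (d : ℝ) ≠ 0 := by positivity
  rw [← Finset.sum_div, Fintype.sum_prod_type]
  simp only [sq_step, Fintype.sum_bool, if_true, Bool.false_eq_true, if_false]
  have : ∀ i : Fin d, sqLen x + 2 * (x i : ℝ) * 1 + 1 + c + (sqLen x + 2 * (x i) * -1 + 1 + c) =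
    2 * (sqLen x + 1 + c) := fun i => by ring
  simp_rw [this]
  simp
  field_simp

lemma exit_bound (d : ℕ) (hd : 2 ≤ d) (n : ℕ) (hn : 0 < n) (t : ℕ) : ∀ x : V d,
    pathLaw d {s | ∃ k ≤ t, pos x s k ∉ ball d n} ≤ ENNReal.ofReal ((sqLen x + t) / (n : ℝ) ^ 2) := by
  have hn2 : (0 : ℝ) < (n : ℝ) ^ 2 := by positivity
  have out : ∀ (t : ℕ) (x : V d), x ∉ ball d n →
      pathLaw d {s | ∃ k ≤ t, pos x s k ∉ ball d n} ≤ ENNReal.ofReal ((sqLen x + t) / (n : ℝ) ^ 2) := by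
    intro t x hx
    refine prob_le_one.trans ?_
    rw [ENNReal.one_le_ofReal, le_div_iff₀ hn2]
    have : (n : ℝ) ^ 2 < sqLen x := by
      by_contra h; exact hx (mem_ball_of x (not_lt.1 h))
    have : (0 : ℝ) ≤ t := by positivity
    linarith
  induction t with
  | zero =>
    intro x
    by_cases hx : x ∈ ball d n
    · have : {s : ℕ → V d | ∃ k ≤ 0, pos x s k ∉ ball d n} = ∅ := by
        ext s; simp [pos_zero, hx]
      rw [this]; simp
    · exact out 0 x hx
  | succ t ih =>
    intro x
    by_cases hx : x ∈ ball d n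
    · rw [pathLaw_step]
      · have h1 : ∀ e, pathLaw d {s | consSeq (e, s) ∈ {s | ∃ k ≤ t + 1, pos x s k ∉ ball d n}} ≤
            ENNReal.ofReal ((fun y => (sqLen y + t) / (n : ℝ) ^ 2) (x + e)) := by
          intro e
          refine le_trans (measure_mono ?_) (ih (x + e))
          rintro s ⟨k, hk, hks⟩
          cases k with
          | zero => rw [pos_zero] at hks; exact absurd hx hks
          | succ k => rw [pos_cons] at hks; exact ⟨k, by omega, hks⟩
        refine (lintegral_mono h1).trans ?_
        rw [lintegral_step d hd (fun y => (sqLen y + t) / (n : ℝ) ^ 2) (fun y => div_nonneg (add_nonneg (sq_nonneg' _) (by positivity)) hn2.le),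
          avg_sq hd]
        apply le_of_eq
        congr 2
        push_cast; ring
      · have : {s : ℕ → V d | ∃ k ≤ t + 1, pos x s k ∉ ball d n} =
          ⋃ k, ⋃ (_ : k ≤ t + 1), (fun s => pos x s k) ⁻¹' ((ball d n : Set (V d))ᶜ) := by
          ext s; simp
        rw [this]
        exact .iUnion fun k => .iUnion fun _ => measurable_pos x k (.of_discrete)
    · exact out _ x hx

/-- one-dimensional heat kernel -/
noncomputable def q : ℕ → ℤ → ℝ
  | 0, x => if x = 0 then 1 else 0
  | k + 1, x => (q k (x + 1) + q k (x - 1)) / 2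

lemma q_formula (k : ℕ) : (∀ j : ℕ, q k (2 * j - k) = (k.choose j : ℝ) / 2 ^ k) ∧
    ∀ x : ℤ, (∀ j : ℕ, x ≠ 2 * j - k) → q k x = 0 := by
  induction k with
  | zero =>
    refine ⟨fun j => ?_, fun x hx => ?_⟩
    · cases j with
      | zero => simp [q]
      | succ j => simp [q]; omega
    · have := hx 0; simp at this; simp [q, this]
  | succ k ih =>
    obtain ⟨ia, ib⟩ := ih
    refine ⟨fun j => ?_, fun x hx => ?_⟩
    · cases j with
      | zero =>
        have h1 : q k (2 * ((0 : ℕ) : ℤ) - ((k + 1 : ℕ) : ℤ) + 1) = 1 / 2 ^ k := by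
          have := ia 0
          rw [show (2 * ((0 : ℕ) : ℤ) - ((k + 1 : ℕ) : ℤ) + 1) = 2 * ((0 : ℕ) : ℤ) - k by push_cast; ring, this]
          simp
        have h2 : q k (2 * ((0 : ℕ) : ℤ) - ((k + 1 : ℕ) : ℤ) - 1) = 0 := by
          apply ib; intro j; push_cast; omega
        rw [q, h1, h2, pow_succ]; simp; field_simp
      | succ j =>
        have h1 : q k (2 * ((j + 1 : ℕ) : ℤ) - ((k + 1 : ℕ) : ℤ) + 1) = (k.choose (j + 1) : ℝ) / 2 ^ k := by
          rw [← ia]; congr 1; push_cast; ring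
        have h2 : q k (2 * ((j + 1 : ℕ) : ℤ) - ((k + 1 : ℕ) : ℤ) - 1) = (k.choose j : ℝ) / 2 ^ k := by
          rw [← ia]; congr 1; push_cast; ring
        rw [q, h1, h2, pow_succ, Nat.choose_succ_succ]; push_cast; field_simp; ring
    · rw [q, ib, ib]
      · simp
      · intro j h; exact hx (j + 1) (by push_cast; omega)
      · intro j h; exact hx j (by push_cast; omega)

lemma centralBinom_bound (m : ℕ) : m.centralBinom ^ 2 * (2 * m + 1) ≤ 16 ^ m := by
  induction m with
  | zero => simp
  | succ m ih =>
    have h := Nat.succ_mul_centralBinom_succ m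
    have h2 : (m + 1) ^ 2 * ((m + 1).centralBinom ^ 2 * (2 * (m + 1) + 1)) ≤
        (m + 1) ^ 2 * 16 ^ (m + 1) := by
      calc (m + 1) ^ 2 * ((m + 1).centralBinom ^ 2 * (2 * (m + 1) + 1))
          = ((m + 1) * (m + 1).centralBinom) ^ 2 * (2 * m + 3) := by ring
        _ = (2 * (2 * m + 1) * m.centralBinom) ^ 2 * (2 * m + 3) := by rw [h]
        _ = (m.centralBinom ^ 2 * (2 * m + 1)) * (4 * (2 * m + 1) * (2 * m + 3)) := by ring
        _ ≤ 16 ^ m * (4 * (2 * m + 1) * (2 * m + 3)) := Nat.mul_le_mul_right _ ih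
        _ ≤ 16 ^ m * (16 * (m + 1) ^ 2) := by
          apply Nat.mul_le_mul_left; nlinarith
        _ = (m + 1) ^ 2 * 16 ^ (m + 1) := by ring
    exact Nat.le_of_mul_le_mul_left h2 (by positivity)

lemma choose_bound (k j : ℕ) : (k.choose j) ^ 2 * (k + 1) ≤ 4 ^ k := by
  have h0 := Nat.choose_le_middle j k
  refine le_trans (Nat.mul_le_mul_right _ (Nat.pow_le_pow_left h0 2)) ?_
  obtain ⟨m, rfl | rfl⟩ := Nat.even_or_odd' k
  · rw [Nat.mul_div_cancel_left m two_pos, pow_mul]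
    exact centralBinom_bound m
  · have h1 : (2 * m + 1) / 2 = m := by omega
    rw [h1]
    have h2 : (m + 1).centralBinom = 2 * (2 * m + 1).choose m := by
      rw [Nat.centralBinom, show 2 * (m + 1) = (2 * m + 1) + 1 by ring, Nat.choose_succ_succ,
        Nat.choose_symm_half]; ring
    have h3 := centralBinom_bound (m + 1)
    rw [h2] at h3
    have h4 : 4 * 4 ^ (2 * m + 1) = 16 ^ (m + 1) := by
      rw [pow_succ, pow_mul, pow_succ]; norm_num; ring
    have h5 : (0 : ℕ) ≤ (2 * m + 1).choose m ^ 2 := Nat.zero_le _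
    nlinarith

lemma q_nonneg (k : ℕ) (x : ℤ) : 0 ≤ q k x := by
  induction k generalizing x with
  | zero => rw [q]; split_ifs <;> norm_num
  | succ k ih => rw [q]; have := ih (x + 1); have := ih (x - 1); positivity

lemma q_bound (k : ℕ) (x : ℤ) : q k x ≤ 1 / √(k + 1) := by
  by_cases h : ∃ j : ℕ, x = 2 * j - k
  · obtain ⟨j, rfl⟩ := h
    rw [(q_formula k).1]
    have hk : (0 : ℝ) < (k : ℝ) + 1 := by positivity
    have hs : (0 : ℝ) < √(k + 1) := Real.sqrt_pos.2 hk
    rw [div_le_div_iff₀ (by positivity) hs, one_mul]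
    refine le_of_sq_le_sq ?_ (by positivity)
    rw [mul_pow, Real.sq_sqrt hk.le, ← pow_mul, mul_comm k 2, pow_mul]
    have := choose_bound k j
    norm_num
    exact_mod_cast this
  · push Not at h
    rw [(q_formula k).2 x h]; positivity

/-- product kernel -/
noncomputable def K {d : ℕ} (m : Fin d → ℕ) (x : V d) : ℝ := ∏ i, q (m i) (x i)

/-- increment a coordinate -/
def inc {d : ℕ} (m : Fin d → ℕ) (i : Fin d) : Fin d → ℕ := fun j => if j = i then m j + 1 else m j

/-- iterated kernel -/
noncomputable def H {d : ℕ} : ℕ → (Fin d → ℕ) → V d → ℝ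
  | 0, m, x => K m x
  | t + 1, m, x => (d : ℝ)⁻¹ * ∑ i, H t (inc m i) x

lemma K_step {d : ℕ} (m : Fin d → ℕ) (x : V d) (i : Fin d) :
    K m (x + uvec (i, true)) + K m (x + uvec (i, false)) = 2 * K (inc m i) x := by
  unfold K
  rw [← Finset.mul_prod_erase Finset.univ _ (Finset.mem_univ i),
    ← Finset.mul_prod_erase Finset.univ (fun j => q (m j) ((x + uvec (i, false)) j)) (Finset.mem_univ i),
    ← Finset.mul_prod_erase Finset.univ (fun j => q (inc m i j) (x j)) (Finset.mem_univ i)]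
  have h1 : ∀ b, ∏ j ∈ Finset.univ.erase i, q (m j) ((x + uvec (i, b)) j) =
      ∏ j ∈ Finset.univ.erase i, q (m j) (x j) := by
    intro b
    refine Finset.prod_congr rfl fun j hj => ?_
    have : j ≠ i := (Finset.mem_erase.1 hj).1
    simp [uvec, this]
  have h2 : ∏ j ∈ Finset.univ.erase i, q (inc m i j) (x j) =
      ∏ j ∈ Finset.univ.erase i, q (m j) (x j) := by
    refine Finset.prod_congr rfl fun j hj => ?_
    have : j ≠ i := (Finset.mem_erase.1 hj).1
    simp [inc, this]
  rw [h1, h1, h2]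
  have e1 : (x + uvec (i, true)) i = x i + 1 := by simp [uvec]
  have e2 : (x + uvec (i, false)) i = x i - 1 := by simp [uvec]; ring
  have e3 : inc m i i = m i + 1 := by simp [inc]
  rw [e1, e2, e3, q]; ring

lemma avg_H {d : ℕ} (hd : 2 ≤ d) (t : ℕ) : ∀ (m : Fin d → ℕ) (x : V d), avg (H t m) x = H (t + 1) m x := by
  have hd' : (d : ℝ) ≠ 0 := by positivity
  induction t with
  | zero =>
    intro m x
    simp only [avg, H]
    rw [Fintype.sum_prod_type]
    simp only [Fintype.sum_bool, K_step]
    rw [← Finset.mul_sum]; field_simp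
  | succ t ih =>
    intro m x
    have : H (t + 1 + 1) m x = (d : ℝ)⁻¹ * ∑ i, H (t + 1) (inc m i) x := rfl
    rw [this]
    simp_rw [← ih]
    simp only [avg, H]
    simp_rw [← Finset.mul_sum]
    rw [Finset.sum_comm]
    ring

lemma H_nonneg {d : ℕ} (t : ℕ) : ∀ (m : Fin d → ℕ) (x : V d), 0 ≤ H t m x := by
  induction t with
  | zero => intro m x; rw [H, K]; exact Finset.prod_nonneg fun _ _ => q_nonneg _ _
  | succ t ih => intro m x; exact mul_nonneg (by positivity) (Finset.sum_nonneg fun _ _ => ih _ _)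

lemma K_bound {d : ℕ} (L : ℝ) (hL : 0 < L) (m : Fin d → ℕ) (x : V d) :
    K m x ≤ (1 / √L) ^ d + ∑ i, Real.exp (L - m i) := by
  unfold K
  by_cases h : ∀ i, L ≤ (m i : ℝ) + 1
  · have : ∏ i, q (m i) (x i) ≤ ∏ _i : Fin d, (1 / √L) := by
      refine Finset.prod_le_prod (fun _ _ => q_nonneg _ _) fun i _ => (q_bound _ _).trans ?_
      exact one_div_le_one_div_of_le (Real.sqrt_pos.2 hL) (Real.sqrt_le_sqrt (h i))
    have h2 : 0 ≤ ∑ i, Real.exp (L - m i) := Finset.sum_nonneg fun _ _ => (Real.exp_pos _).le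
    simp at this
    simp only [one_div]
    rw [← inv_pow] at this
    linarith
  · push Not at h
    obtain ⟨i, hi⟩ := h
    have h1 : ∏ i, q (m i) (x i) ≤ 1 := by
      refine Finset.prod_le_one (fun _ _ => q_nonneg _ _) fun i _ => (q_bound _ _).trans ?_
      rw [div_le_one (by positivity)]
      exact Real.one_le_sqrt.2 (by simp)
    have h2 : 1 ≤ Real.exp (L - m i) := Real.one_le_exp (by linarith)
    have h3 : Real.exp (L - m i) ≤ ∑ i, Real.exp (L - m i) :=
      Finset.single_le_sum (f := fun i => Real.exp (L - m i)) (fun _ _ => (Real.exp_pos _).le) (Finset.mem_univ i)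
    have h4 : 0 ≤ (1 / √L) ^ d := by positivity
    linarith

/-- Chernoff rate -/
noncomputable def rate (d : ℕ) : ℝ := 1 - (1 - Real.exp (-1)) / d

lemma H_bound {d : ℕ} (hd : 2 ≤ d) (L : ℝ) (hL : 0 < L) (x : V d) (t : ℕ) : ∀ (m : Fin d → ℕ),
    H t m x ≤ (1 / √L) ^ d + (∑ i, Real.exp (L - m i)) * rate d ^ t := by
  have hd' : (0 : ℝ) < d := by positivity
  induction t with
  | zero => intro m; simpa [H] using K_bound L hL m x
  | succ t ih =>
    intro m
    have key : ∑ j, ∑ i, Real.exp (L - (inc m j i : ℕ)) = d * (∑ i, Real.exp (L - m i)) * rate d := by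
      rw [Finset.sum_comm]
      have : ∀ i, ∑ j, Real.exp (L - (inc m j i : ℕ)) = d * Real.exp (L - m i) * rate d := by
        intro i
        have e : ∀ j, Real.exp (L - (inc m j i : ℕ)) = Real.exp (L - m i) +
            if i = j then Real.exp (L - m i) * (Real.exp (-1) - 1) else 0 := by
          intro j
          unfold inc
          split_ifs
          · push_cast
            rw [show L - ((m i : ℝ) + 1) = (L - m i) + (-1) by ring, Real.exp_add]; ring
          · simp
        simp_rw [e]
        rw [Finset.sum_add_distrib, Finset.sum_ite_eq]
        simp [rate]; field_simp; ring
      simp_rw [this]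
      rw [← Finset.sum_mul, ← Finset.mul_sum]
    calc H (t + 1) m x = (d : ℝ)⁻¹ * ∑ j, H t (inc m j) x := rfl
      _ ≤ (d : ℝ)⁻¹ * ∑ j, ((1 / √L) ^ d + (∑ i, Real.exp (L - (inc m j i : ℕ))) * rate d ^ t) := by
        gcongr with j; exact ih _
      _ = _ := by
        rw [Finset.sum_add_distrib, ← Finset.sum_mul, key, pow_succ]
        simp
        field_simp

/-- heat kernel constant -/
noncomputable def hkC (d : ℕ) : ℝ := √(2 * d) ^ d + d * (d.factorial * (10 * d) ^ d)

lemma hkC_pos (d : ℕ) (hd : 2 ≤ d) : 0 < hkC d := by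
  unfold hkC; positivity

lemma heat_bound {d : ℕ} (hd : 2 ≤ d) (t : ℕ) (ht : 1 ≤ t) (x : V d) :
    H t 0 x ≤ hkC d / √t ^ d := by
  have hd' : (0 : ℝ) < d := by positivity
  have ht' : (1 : ℝ) ≤ t := by exact_mod_cast ht
  have h := H_bound hd ((t : ℝ) / (2 * d)) (by positivity) x t 0
  refine h.trans ?_
  have e1 : (1 / √((t : ℝ) / (2 * d))) ^ d = √(2 * d) ^ d / √t ^ d := by
    rw [Real.sqrt_div (by positivity), one_div_div, div_pow]
  rw [e1, hkC, add_div]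
  gcongr
  simp only [Pi.zero_apply, Nat.cast_zero, sub_zero, Finset.sum_const, Finset.card_univ,
    Fintype.card_fin, nsmul_eq_mul]
  rw [mul_assoc, mul_div_assoc]
  gcongr
  have hexp : Real.exp (-1) ≤ 0.4 := by
    have := Real.exp_one_gt_d9
    rw [Real.exp_neg, inv_le_comm₀ (Real.exp_pos _) (by norm_num)]; norm_num; linarith
  have hr0 : 0 ≤ rate d := by
    unfold rate
    have : (1 - Real.exp (-1)) / d ≤ 1 := by
      rw [div_le_one hd']
      have := Real.exp_pos (-1)
      have : (2 : ℝ) ≤ d := by exact_mod_cast hd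
      linarith
    linarith
  have hr : rate d ≤ Real.exp (-(0.6 / d)) := by
    have h1 := Real.add_one_le_exp (-(0.6 / (d : ℝ)))
    have h2 : 0.6 / (d : ℝ) ≤ (1 - Real.exp (-1)) / d := by gcongr; linarith
    unfold rate; linarith
  have hs : 0 < (t : ℝ) / (10 * d) := by positivity
  calc Real.exp ((t : ℝ) / (2 * d)) * rate d ^ t
      ≤ Real.exp ((t : ℝ) / (2 * d)) * Real.exp (-(0.6 / d)) ^ t := by gcongr
    _ = Real.exp (-((t : ℝ) / (10 * d))) := by
      rw [← Real.exp_nat_mul, ← Real.exp_add]; congr 1; field_simp; ring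
    _ ≤ (d.factorial * (10 * d) ^ d) / (t : ℝ) ^ d := by
      have := Real.pow_div_factorial_le_exp ((t : ℝ) / (10 * d)) hs.le d
      rw [Real.exp_neg]
      refine (inv_anti₀ (by positivity) this).trans (le_of_eq ?_)
      rw [div_pow]; field_simp
    _ ≤ (d.factorial * (10 * d) ^ d) / √t ^ d := by
      gcongr
      exact Real.sqrt_le_iff.2 ⟨by positivity, by nlinarith⟩

lemma pos_prob (d : ℕ) (hd : 2 ≤ d) (y : V d) (t : ℕ) : ∀ x : V d,
    pathLaw d {s | pos x s t = y} = ENNReal.ofReal (H t 0 (x - y)) := by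
  induction t with
  | zero =>
    intro x
    simp only [pos_zero, H, K, Pi.zero_apply, q]
    by_cases h : x = y
    · subst h; simp
    · have : ∃ i, x i ≠ y i := by by_contra hc; push Not at hc; exact h (funext hc)
      obtain ⟨i, hi⟩ := this
      rw [Finset.prod_eq_zero (Finset.mem_univ i) (by simp [sub_eq_zero, hi])]
      simp [h]
  | succ t ih =>
    intro x
    rw [pathLaw_step]
    · have : ∀ e, pathLaw d {s | consSeq (e, s) ∈ {s | pos x s (t + 1) = y}} =
          ENNReal.ofReal (H t 0 ((x - y) + e)) := by
        intro e
        have h1 : {s | consSeq (e, s) ∈ {s | pos x s (t + 1) = y}} = {s | pos (x + e) s t = y} := by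
          ext s; simp only [Set.mem_ofPred_eq]; rw [pos_cons]
        rw [h1, ih]; congr 2; abel
      simp_rw [this]
      rw [lintegral_step d hd _ (fun z => H_nonneg _ _ z), avg_H hd]
    · exact measurable_pos x _ (measurableSet_singleton y)

lemma set_prob (d : ℕ) (hd : 2 ≤ d) (S : Finset (V d)) (t : ℕ) (ht : 1 ≤ t) (x : V d) :
    pathLaw d {s | pos x s t ∈ S} ≤ ENNReal.ofReal (S.card * (hkC d / √t ^ d)) := by
  have : {s | pos x s t ∈ S} = ⋃ y ∈ S, {s | pos x s t = y} := by ext s; simp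
  rw [this]
  refine (measure_biUnion_finset_le _ _).trans ?_
  have : ∀ y ∈ S, pathLaw d {s | pos x s t = y} ≤ ENNReal.ofReal (hkC d / √t ^ d) := by
    intro y _
    rw [pos_prob d hd]
    exact ENNReal.ofReal_le_ofReal (heat_bound hd t ht _)
  refine (Finset.sum_le_card_nsmul _ _ _ this).trans (le_of_eq ?_)
  rw [nsmul_eq_mul, ENNReal.ofReal_mul (by positivity), ENNReal.ofReal_natCast]

lemma event_bound (d : ℕ) (hd : 2 ≤ d) (n : ℕ) (hn : 0 < n) (S : Finset (V d)) (t : ℕ) (ht : 1 ≤ t) :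
    μ0 {ω | hitPt S 0 ω ∈ outb (ball d n)} ≤
      ENNReal.ofReal (t / (n : ℝ) ^ 2) + ENNReal.ofReal (S.card * (hkC d / √t ^ d)) := by
  have hw : ∀ ω k, walk (0 : V d) ω k = pos 0 (fun i => pick (unitVecs d) (uSlice ω i)) k :=
    fun _ _ => rfl
  have hsub : {ω | hitPt S 0 ω ∈ outb (ball d n)} ⊆
      (fun ω i => pick (unitVecs d) (uSlice ω i)) ⁻¹'
        ({s | ∃ k ≤ t, pos 0 s k ∉ ball d n} ∪ {s | pos 0 s t ∈ S}) := by
    intro ω hω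
    by_contra hc
    simp only [Set.mem_preimage, Set.mem_union, Set.mem_ofPred_eq, ← hw, not_or, not_exists,
      not_and, not_not] at hc
    have h1 : hitPt S 0 ω ∉ ball d n := (Finset.mem_sdiff.1 hω).2
    have h2 : t < exitT S 0 ω := by
      by_contra h; exact h1 (hc.1 _ (not_lt.1 h))
    have h3 := Nat.notMem_of_lt_sInf h2
    exact h3 hc.2
  have hm : MeasurableSet ({s : ℕ → V d | ∃ k ≤ t, pos 0 s k ∉ ball d n} ∪ {s | pos 0 s t ∈ S}) := by
    refine MeasurableSet.union ?_ (measurable_pos 0 t (.of_discrete (s := (S : Set (V d)))))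
    have : {s : ℕ → V d | ∃ k ≤ t, pos 0 s k ∉ ball d n} =
      ⋃ k, ⋃ (_ : k ≤ t), (fun s => pos 0 s k) ⁻¹' ((ball d n : Set (V d))ᶜ) := by
      ext s; simp
    rw [this]
    exact .iUnion fun k => .iUnion fun _ => measurable_pos 0 k (.of_discrete)
  refine (measure_mono hsub).trans ?_
  rw [← Measure.map_apply (measurable_steps d) hm, map_steps]
  refine (measure_union_le _ _).trans (add_le_add ?_ (set_prob d hd S t ht 0))
  have := exit_bound d hd n hn t 0
  simpa [sqLen] using this

lemma bn_le (d n : ℕ) (hn : 1 ≤ n) : (bn d n : ℝ) ≤ (3 * n) ^ d := by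
  classical
  have h : bn d n ≤ (2 * n + 1) ^ d := by
    unfold bn ball
    refine (Finset.card_filter_le _ _).trans ?_
    rw [Pi.card_Icc]
    simp only [Int.card_Icc, Finset.prod_const, Finset.card_univ, Fintype.card_fin]
    apply Nat.pow_le_pow_left
    simp; omega
  calc (bn d n : ℝ) ≤ ((2 * n + 1) ^ d : ℕ) := by exact_mod_cast h
    _ ≤ (3 * n) ^ d := by
      push_cast
      have : (1 : ℝ) ≤ n := by exact_mod_cast hn
      gcongr; linarith

theorem statement7 (d : ℕ) (hd : 2 ≤ d) (p : ℝ) (hp : 0 < p) :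
    ∃ ε : ℝ, 0 < ε ∧ ∃ N : ℕ, ∀ n : ℕ, N ≤ n →
      ∀ S : Finset (V d), S ⊆ ball d n → (S.card : ℝ) ≤ ε * bn d n →
        μ0 {ω | hitPt S 0 ω ∈ outb (ball d n)} ≤ ENNReal.ofReal p := by
  set δ : ℝ := p / 2 with hδ
  have hδ0 : 0 < δ := by positivity
  have hC := hkC_pos d hd
  set c : ℝ := 3 ^ d * √(2 / δ) ^ d * hkC d with hc
  have hc0 : 0 < c := by
    have : 0 < √(2 / δ) := Real.sqrt_pos.2 (by positivity)
    positivity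
  refine ⟨p / 2 / c, by positivity, ⌈2 / δ⌉₊ + 1, fun n hn S hS hcard => ?_⟩
  have hn1 : 1 ≤ n := by omega
  have hnR : (1 : ℝ) ≤ n := by exact_mod_cast hn1
  have hnd : 2 / δ ≤ n := (Nat.le_ceil _).trans (by exact_mod_cast (by omega : ⌈2 / δ⌉₊ ≤ n))
  have hnd2 : 2 ≤ δ * n := by rw [div_le_iff₀ hδ0] at hnd; linarith
  have hbig : 2 ≤ δ * (n : ℝ) ^ 2 := by nlinarith
  set t : ℕ := ⌊δ * (n : ℝ) ^ 2⌋₊ with ht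
  have htle : (t : ℝ) ≤ δ * (n : ℝ) ^ 2 := Nat.floor_le (by positivity)
  have htlt : δ * (n : ℝ) ^ 2 < t + 1 := Nat.lt_floor_add_one _
  have htge : δ / 2 * (n : ℝ) ^ 2 ≤ t := by linarith
  have ht1 : 1 ≤ t := Nat.le_floor (by push_cast; linarith)
  have ht0 : (0 : ℝ) < t := by exact_mod_cast ht1
  refine (event_bound d hd n hn1 S t ht1).trans ?_
  rw [← ENNReal.ofReal_add (by positivity) (by positivity)]
  apply ENNReal.ofReal_le_ofReal
  have h1 : (t : ℝ) / (n : ℝ) ^ 2 ≤ p / 2 := by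
    rw [div_le_iff₀ (by positivity)]; exact htle
  have h2 : (n : ℝ) / √t ≤ √(2 / δ) := by
    rw [div_le_iff₀ (Real.sqrt_pos.2 ht0), ← Real.sqrt_mul (by positivity)]
    apply Real.le_sqrt_of_sq_le
    have : (n : ℝ) ^ 2 = 2 / δ * (δ / 2 * (n : ℝ) ^ 2) := by field_simp
    rw [this]; gcongr
  have h3 : (S.card : ℝ) * (hkC d / √t ^ d) ≤ p / 2 := by
    calc (S.card : ℝ) * (hkC d / √t ^ d)
        ≤ (p / 2 / c * (3 * n) ^ d) * (hkC d / √t ^ d) := by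
          gcongr
          refine hcard.trans ?_
          gcongr
          exact bn_le d n hn1
      _ = p / 2 / c * (3 ^ d * (n / √t) ^ d * hkC d) := by rw [mul_pow, div_pow]; ring
      _ ≤ p / 2 / c * (3 ^ d * √(2 / δ) ^ d * hkC d) := by gcongr
      _ = p / 2 := by rw [← hc]; field_simp
  linarith
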